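/- Let M ≥ 1 be an integer, τ > 0 and l ≥ 0. Then the probability of missed detection of the norm-threshold test when only the statistics of the large-scale fading are known satisfies ∫_{{r ∈ ℂ^M : ‖r‖ < l}} (∫₀^∞ (a·g^{−γ}·Q(g)/(π^M·(g²+τ²)^M))·exp(−‖r‖²/(g²+τ²)) dg) dr = ∫₀^∞ (a·g^{−γ}·Q(g)/Γ(M))·(∫₀^{l²/(g²+τ²)} t^{M−1}·e^{−t} dt) dg, where Γ is the Gamma function and the outer integral on the left is with respect to Lebesgue measure on ℂ^M ≅ ℝ^{2M}. -/

import Mathlib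

open MeasureTheory Set
open scoped ENNReal

noncomputable section

/-- `Q(g) = ∫_{b ln g + c}^∞ exp(-s²) ds`. -/
def Qfun (b c g : ℝ) : ℝ := ∫ s in Set.Ioi (b * Real.log g + c), Real.exp (-s ^ 2)

/-- Squared Euclidean norm on `ℂ^M ≅ ℝ^{2M}`. -/
def nsq {M : ℕ} (r : Fin M → ℂ) : ℝ := ∑ i, ‖r i‖ ^ 2

/-- Circularly symmetric complex Gaussian density of variance `v` on `ℂ^M ≅ ℝ^{2M}`:
`φ_v^{(M)}(r) = (πv)^{-M} exp(-‖r‖²/v)`. -/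
def vgauss (M : ℕ) (v : ℝ) (r : Fin M → ℂ) : ℝ :=
  ((Real.pi * v) ^ M)⁻¹ * Real.exp (-nsq r / v)

/-- Channel-row density `q_M(r) = a π^{-M} ∫₀^∞ g^{-γ-2M} Q(g) exp(-‖r‖²/g²) dg`. -/
def qM (a γ b c : ℝ) (M : ℕ) (r : Fin M → ℂ) : ℝ :=
  a / Real.pi ^ M *
    ∫ g in Set.Ioi (0 : ℝ), g ^ (-γ - 2 * (M : ℝ)) * Qfun b c g * Real.exp (-nsq r / g ^ 2)

lemma integrable_exp_neg_sq : Integrable fun s : ℝ => Real.exp (-s ^ 2) := by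
  simpa using integrable_exp_neg_mul_sq one_pos

lemma Qfun_nonneg (b c g : ℝ) : 0 ≤ Qfun b c g :=
  integral_nonneg fun _ => (Real.exp_pos _).le

lemma Qfun_le_integral (b c g : ℝ) : Qfun b c g ≤ ∫ s : ℝ, Real.exp (-s ^ 2) :=
  setIntegral_le_integral integrable_exp_neg_sq (ae_of_all _ fun _ => (Real.exp_pos _).le)

lemma measurable_Qfun (b c : ℝ) : Measurable (Qfun b c) := by
  have h : Antitone fun x : ℝ => ∫ s in Set.Ioi x, Real.exp (-s ^ 2) := fun x y hxy =>
    setIntegral_mono_set integrable_exp_neg_sq.integrableOn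
      (ae_of_all _ fun _ => (Real.exp_pos _).le) (Ioi_subset_Ioi hxy).eventuallyLE
  exact h.measurable.comp ((Real.measurable_log.const_mul b).add_const c)

/-- Chernoff-type bound for the Gaussian tail. -/
lemma Qfun_le_exp (b c g : ℝ) {k : ℝ} (hk : 0 < k) :
    Qfun b c g ≤ Real.exp (k ^ 2) * (Real.exp (-(2 * k) * (b * Real.log g + c)) / (2 * k)) := by
  have hk' : -(2 * k) < 0 := by linarith
  calc Qfun b c g
      ≤ ∫ s in Set.Ioi (b * Real.log g + c), Real.exp (k ^ 2) * Real.exp (-(2 * k) * s) := by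
        refine setIntegral_mono integrable_exp_neg_sq.integrableOn
          ((integrableOn_exp_mul_Ioi hk' _).const_mul _) fun s => ?_
        rw [← Real.exp_add]
        exact Real.exp_le_exp.2 (by nlinarith [sq_nonneg (s - k)])
    _ = _ := by
        rw [integral_const_mul, integral_exp_mul_Ioi hk', neg_div_neg_eq]

lemma integrableOn_rpow_mul_Qfun {γ b : ℝ} (c : ℝ) (hγ : 1 < γ) (hb : b < 0) :
    IntegrableOn (fun g : ℝ => g ^ (-γ) * Qfun b c g) (Ioi 0) := by
  have hmeas : Measurable fun g : ℝ => g ^ (-γ) * Qfun b c g :=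
    (measurable_id.pow_const _).mul (measurable_Qfun b c)
  rw [← Ioc_union_Ioi_eq_Ioi zero_le_one]
  refine IntegrableOn.union ?_ ?_
  · set k : ℝ := γ / (2 * -b) with hkdef
    have hk : 0 < k := by apply div_pos <;> linarith
    have hkb : 2 * k * b = -γ := by
      have := hb.ne
      rw [hkdef]
      field_simp
    refine Integrable.mono' (g := fun _ => Real.exp (k ^ 2) *
        (Real.exp (-(2 * k) * c) / (2 * k))) (integrable_const _) hmeas.aestronglyMeasurable ?_
    filter_upwards [ae_restrict_mem measurableSet_Ioc] with g hg
    have hg0 : 0 < g := hg.1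
    rw [Real.norm_of_nonneg (mul_nonneg (Real.rpow_nonneg hg0.le _) (Qfun_nonneg ..))]
    calc g ^ (-γ) * Qfun b c g
        ≤ g ^ (-γ) * (Real.exp (k ^ 2) *
          (Real.exp (-(2 * k) * (b * Real.log g + c)) / (2 * k))) := by
          gcongr
          exact Qfun_le_exp b c g hk
      _ = (g ^ (-γ) * g ^ γ) * (Real.exp (k ^ 2) * (Real.exp (-(2 * k) * c) / (2 * k))) := by
          have : -(2 * k) * (b * Real.log g + c) = Real.log g * γ + -(2 * k) * c := by
            linear_combination (-Real.log g) * hkb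
          rw [this, Real.exp_add, ← Real.rpow_def_of_pos hg0]
          ring
      _ = _ := by rw [← Real.rpow_add hg0]; simp
  · refine Integrable.mono' ((integrableOn_Ioi_rpow_of_lt (a := -γ) (by linarith)
      zero_lt_one).mul_const (∫ s : ℝ, Real.exp (-s ^ 2))) hmeas.aestronglyMeasurable ?_
    filter_upwards [ae_restrict_mem measurableSet_Ioi] with g hg
    have hg0 : 0 < g := zero_lt_one.trans hg
    rw [Real.norm_of_nonneg (mul_nonneg (Real.rpow_nonneg hg0.le _) (Qfun_nonneg ..))]
    gcongr
    exact Qfun_le_integral b c g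

lemma nsq_nonneg {M : ℕ} (r : Fin M → ℂ) : 0 ≤ nsq r :=
  Finset.sum_nonneg fun _ _ => sq_nonneg _

lemma continuous_nsq (M : ℕ) : Continuous (nsq : (Fin M → ℂ) → ℝ) := by
  unfold nsq; fun_prop

lemma measurableSet_sqrt_nsq_lt (M : ℕ) (l : ℝ) :
    MeasurableSet {r : Fin M → ℂ | Real.sqrt (nsq r) < l} :=
  (isOpen_lt (continuous_nsq M).sqrt continuous_const).measurableSet

lemma volume_sqrt_nsq_lt {M : ℕ} (hM : 1 ≤ M) (l : ℝ) :
    volume {r : Fin M → ℂ | Real.sqrt (nsq r) < l} =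
      ENNReal.ofReal l ^ (2 * M) * ENNReal.ofReal (Real.pi ^ M / Real.Gamma (M + 1)) := by
  have : Nonempty (Fin M) := ⟨⟨0, hM⟩⟩
  have h := Complex.volume_sum_rpow_lt (Fin M) (p := 2) one_le_two l
  simp only [Real.rpow_two, ← Real.sqrt_eq_rpow, Fintype.card_fin] at h
  have h1 : (2 : ℝ) / 2 + 1 = 2 := by norm_num
  have h2 : 2 * (M : ℝ) / 2 + 1 = M + 1 := by ring
  rw [h1, h2, Real.Gamma_two, mul_one] at h
  exact h

lemma integral_fun_sqrt_nsq {M : ℕ} (hM : 1 ≤ M) (f : ℝ → ℝ) :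
    ∫ r : Fin M → ℂ, f (Real.sqrt (nsq r)) =
      2 * (Real.pi ^ M / Real.Gamma M) * ∫ y in Ioi (0 : ℝ), y ^ (2 * M - 1) * f y := by
  have : Nonempty (Fin M) := ⟨⟨0, hM⟩⟩
  let E := EuclideanSpace ℂ (Fin M)
  let L : (Fin M → ℂ) ≃L[ℝ] E := (PiLp.continuousLinearEquiv 2 ℝ fun _ : Fin M => ℂ).symm
  let μ : Measure E := volume.map L
  have : μ.IsAddHaarMeasure := L.isAddHaarMeasure_map _
  have hL : MeasurableEmbedding L := L.toHomeomorph.measurableEmbedding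
  have hnorm (r : Fin M → ℂ) : ‖L r‖ = Real.sqrt (nsq r) := EuclideanSpace.norm_eq _
  have hdim : Module.finrank ℝ E = 2 * M := by
    rw [← L.toLinearEquiv.finrank_eq]
    simp [Module.finrank_pi_fintype, Complex.finrank_real_complex, mul_comm]
  have hball : μ.real (Metric.ball 0 1) = Real.pi ^ M / Real.Gamma (M + 1) := by
    have : L ⁻¹' Metric.ball 0 1 = {r : Fin M → ℂ | Real.sqrt (nsq r) < 1} := by
      ext r; simp [hnorm]
    rw [Measure.real, hL.map_apply, this, volume_sqrt_nsq_lt hM]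
    have := Real.Gamma_pos_of_pos (s := (M : ℝ) + 1) (by positivity)
    simp only [ENNReal.ofReal_one, one_pow, one_mul]
    exact ENNReal.toReal_ofReal (by positivity)
  have hM0 : (M : ℝ) ≠ 0 := by exact_mod_cast (by omega : M ≠ 0)
  have h := integral_fun_norm_addHaar μ f
  rw [hL.integral_map, hdim, hball, Real.Gamma_add_one hM0] at h
  simp only [hnorm, nsmul_eq_mul, smul_eq_mul] at h
  rw [h, ← mul_assoc]
  congr 1
  push_cast
  have := (Real.Gamma_pos_of_pos (s := (M : ℝ)) (by positivity)).ne'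
  field_simp

lemma integral_pow_mul_exp_neg_sq_div {M : ℕ} (hM : 1 ≤ M) {v l : ℝ} (hv : 0 < v) :
    2 * ∫ y in (0 : ℝ)..l, y ^ (2 * M - 1) * Real.exp (-y ^ 2 / v) =
      v ^ M * ∫ t in (0 : ℝ)..l ^ 2 / v, t ^ (M - 1) * Real.exp (-t) := by
  have h := intervalIntegral.integral_comp_mul_deriv (a := 0) (b := l)
    (f := fun y : ℝ => y ^ 2 / v) (f' := fun y => 2 * y / v)
    (g := fun t : ℝ => t ^ (M - 1) * Real.exp (-t))
    (fun x _ => by simpa using (hasDerivAt_pow 2 x).div_const v)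
    (by fun_prop) (by fun_prop)
  simp only [ne_eq, OfNat.ofNat_ne_zero, not_false_eq_true, zero_pow, zero_div] at h
  rw [← h, ← intervalIntegral.integral_const_mul, ← intervalIntegral.integral_const_mul]
  congr 1 with y
  obtain ⟨n, rfl⟩ : ∃ n, M = n + 1 := ⟨M - 1, by omega⟩
  simp only [Function.comp, Nat.add_sub_cancel, neg_div, div_pow,
    show 2 * (n + 1) - 1 = 2 * n + 1 by omega]
  field_simp
  ring

/-- The mass a Gaussian profile of variance `v` puts on a ball of `ℂ^M`, through the lower
incomplete Gamma function. -/
lemma setIntegral_exp_neg_nsq_div {M : ℕ} (hM : 1 ≤ M) {v l : ℝ} (hv : 0 < v) (hl : 0 ≤ l) :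
    ∫ r in {r : Fin M → ℂ | Real.sqrt (nsq r) < l}, Real.exp (-nsq r / v) =
      Real.pi ^ M * v ^ M / Real.Gamma M *
        ∫ t in Ioc (0 : ℝ) (l ^ 2 / v), t ^ (M - 1) * Real.exp (-t) := by
  have h := integral_fun_sqrt_nsq hM ((Iio l).indicator fun y => Real.exp (-y ^ 2 / v))
  have hleft : (fun r : Fin M → ℂ => (Iio l).indicator (fun y => Real.exp (-y ^ 2 / v))
        (Real.sqrt (nsq r))) =
      {r : Fin M → ℂ | Real.sqrt (nsq r) < l}.indicator fun r => Real.exp (-nsq r / v) := by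
    ext r
    simp [indicator, Real.sq_sqrt (nsq_nonneg r)]
  have hright : (fun y : ℝ => y ^ (2 * M - 1) * (Iio l).indicator
        (fun y => Real.exp (-y ^ 2 / v)) y) =
      (Iio l).indicator fun y => y ^ (2 * M - 1) * Real.exp (-y ^ 2 / v) := by
    ext y
    simp [indicator]
  rw [hleft, hright, integral_indicator (measurableSet_sqrt_nsq_lt M l),
    setIntegral_indicator measurableSet_Iio, Ioi_inter_Iio, ← integral_Ioc_eq_integral_Ioo,
    ← intervalIntegral.integral_of_le hl] at h
  rw [h, ← intervalIntegral.integral_of_le (by positivity)]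
  linear_combination (Real.pi ^ M / Real.Gamma M) *
    integral_pow_mul_exp_neg_sq_div hM (l := l) hv

/-- missed-detection probability of the norm-threshold test when only the
statistics of the large-scale fading are known. -/
theorem stmt17
    (M : ℕ) (hM : 1 ≤ M)
    (R α β σ : ℝ) (hR : 0 < R) (hβ : 0 < β) (hσ : 0 < σ)
    (γ a b c : ℝ)
    (hγ : γ = 40 / β + 1)
    (ha : a = 40 / (R ^ 2 * β * Real.sqrt Real.pi) *
      Real.exp (2 * (Real.log 10) ^ 2 * σ ^ 2 / β ^ 2 - 2 * (Real.log 10) * α / β))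
    (hb : b = -10 * Real.sqrt 2 / ((Real.log 10) * σ))
    (hc : c = (-α - β * Real.logb 10 R) / (Real.sqrt 2 * σ) - 20 / (β * b))
    (τ l : ℝ) (hτ : 0 < τ) (hl : 0 ≤ l) :
    ∫ r in {r : Fin M → ℂ | Real.sqrt (nsq r) < l},
        ∫ g in Set.Ioi (0 : ℝ),
          a * g ^ (-γ) * Qfun b c g / (Real.pi ^ M * (g ^ 2 + τ ^ 2) ^ M) *
            Real.exp (-nsq r / (g ^ 2 + τ ^ 2)) =
      ∫ g in Set.Ioi (0 : ℝ),
        a * g ^ (-γ) * Qfun b c g / Real.Gamma M *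
          ∫ t in Set.Ioc (0 : ℝ) (l ^ 2 / (g ^ 2 + τ ^ 2)), t ^ (M - 1) * Real.exp (-t) := by
  have hγ1 : 1 < γ := by
    rw [hγ]
    linarith [div_pos (by norm_num : (0 : ℝ) < 40) hβ]
  have hb0 : b < 0 := by
    rw [hb]
    have := Real.log_pos (by norm_num : (1 : ℝ) < 10)
    exact div_neg_of_neg_of_pos (by nlinarith [Real.sqrt_pos.2 (two_pos (α := ℝ))])
      (by positivity)
  have hpos (g : ℝ) : 0 < g ^ 2 + τ ^ 2 := by positivity
  set S := {r : Fin M → ℂ | Real.sqrt (nsq r) < l}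
  have : IsFiniteMeasure ((volume : Measure (Fin M → ℂ)).restrict S) := by
    refine ⟨?_⟩
    rw [Measure.restrict_apply_univ, volume_sqrt_nsq_lt hM]
    exact ENNReal.mul_lt_top (ENNReal.pow_lt_top ENNReal.ofReal_lt_top) ENNReal.ofReal_lt_top
  have hint : Integrable (Function.uncurry fun (r : Fin M → ℂ) (g : ℝ) =>
      a * g ^ (-γ) * Qfun b c g / (Real.pi ^ M * (g ^ 2 + τ ^ 2) ^ M) *
        Real.exp (-nsq r / (g ^ 2 + τ ^ 2)))
      ((volume.restrict S).prod (volume.restrict (Ioi (0 : ℝ)))) := by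
    have hh : Integrable (fun g : ℝ => a * (g ^ (-γ) * Qfun b c g))
        (volume.restrict (Ioi (0 : ℝ))) := (integrableOn_rpow_mul_Qfun c hγ1 hb0).const_mul a
    refine ((hh.comp_snd (volume.restrict S)).norm.mul_const
      (Real.pi ^ M * (τ ^ 2) ^ M)⁻¹).mono' ?_ (ae_of_all _ fun p => ?_)
    · have hn := (continuous_nsq M).measurable
      have hQ := measurable_Qfun b c
      refine Measurable.aestronglyMeasurable ?_
      unfold Function.uncurry
      fun_prop
    · have hexp : Real.exp (-nsq p.1 / (p.2 ^ 2 + τ ^ 2)) ≤ 1 := Real.exp_le_one_iff.2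
        (div_nonpos_of_nonpos_of_nonneg (neg_nonpos.2 (nsq_nonneg _)) (hpos _).le)
      have hden : (Real.pi ^ M * (p.2 ^ 2 + τ ^ 2) ^ M)⁻¹ ≤ (Real.pi ^ M * (τ ^ 2) ^ M)⁻¹ := by
        gcongr
        linarith [sq_nonneg p.2]
      rw [Function.uncurry_def, norm_mul, Real.norm_of_nonneg (Real.exp_pos _).le, div_eq_mul_inv,
        norm_mul, mul_assoc a, Real.norm_of_nonneg (r := (Real.pi ^ M * _)⁻¹)
          (inv_nonneg.2 (by have := hpos p.2; positivity))]
      exact (mul_le_of_le_one_right (by have := hpos p.2; positivity) hexp).trans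
        (mul_le_mul_of_nonneg_left hden (norm_nonneg _))
  rw [integral_integral_swap hint]
  refine setIntegral_congr_fun measurableSet_Ioi fun g _ => ?_
  have hg := (hpos g).ne'
  have hπ := Real.pi_ne_zero
  rw [integral_const_mul, setIntegral_exp_neg_nsq_div hM (hpos g) hl]
  field_simp
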